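/- Let ℓ be a prime, let Γ be a finite abelian group, and let T_1, …, T_s be subgroups of Γ. For each i let S_i denote the ℓ-Sylow subgroup of T_i. Assume that the ℓ-Sylow subgroup of Γ is the internal direct product of the subgroups S_1, …, S_s. Then the quotient ℤ[Γ]/(s(T_1), …, s(T_s)) of the integral group ring by the ideal generated by the norm elements s(T_i) has no ℓ-torsion, i.e. its torsion subgroup contains no element of order ℓ. -/

import Mathlib

set_option maxHeartbeats 1000000

/-- The norm element `s(T) = Σ_{t ∈ T} t` of a subgroup `T`, in the integral group ring. -/
noncomputable def sElt {G : Type} [Group G] [Finite G] (T : Subgroup G) :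
    MonoidAlgebra ℤ G :=
  letI : Fintype T := Fintype.ofFinite _
  ∑ t : T, MonoidAlgebra.of ℤ G (t : G)

open MonoidAlgebra

section NormElement

variable {G : Type} [CommGroup G] [Finite G]

lemma of_mul_sElt (T : Subgroup G) {g : G} (hg : g ∈ T) :
    of ℤ G g * sElt T = sElt T := by
  let _ : Fintype T := Fintype.ofFinite _
  simp only [sElt, Finset.mul_sum, ← map_mul]
  exact Fintype.sum_equiv (Equiv.mulLeft (⟨g, hg⟩ : T)) _ _ fun t => rfl

lemma sElt_mul_self (T : Subgroup G) : sElt T * sElt T = Nat.card T • sElt T := by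
  let _ : Fintype T := Fintype.ofFinite _
  conv_lhs => enter [1]; rw [sElt]
  rw [Finset.sum_mul, Finset.sum_congr rfl fun t _ => of_mul_sElt T t.2]
  simp [Nat.card_eq_fintype_card]

lemma sElt_sup_of_disjoint {S W : Subgroup G} (h : Disjoint S W) :
    sElt (S ⊔ W) = sElt S * sElt W := by
  let _ : Fintype S := Fintype.ofFinite _
  let _ : Fintype W := Fintype.ofFinite _
  let _ : Fintype (S ⊔ W : Subgroup G) := Fintype.ofFinite _
  simp only [sElt, Finset.sum_mul_sum, ← map_mul]
  rw [← Fintype.sum_prod_type']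
  symm
  refine Fintype.sum_bijective
    (fun p : S × W => (⟨p.1 * p.2, Subgroup.mul_mem_sup p.1.2 p.2.2⟩ : (S ⊔ W : Subgroup G)))
    ⟨fun p q hpq => ?_, fun x => ?_⟩ _ _ fun p => rfl
  · exact Subgroup.mul_injective_of_disjoint h (congrArg Subtype.val hpq)
  · obtain ⟨y, hy, z, hz, hyz⟩ := Subgroup.mem_sup.1 x.2
    exact ⟨(⟨y, hy⟩, ⟨z, hz⟩), Subtype.ext hyz⟩

end NormElement

section Restriction

variable {G : Type} [CommGroup G]

open Classical in
/-- The additive projection of `ℤ[G]` onto the elements supported on the subgroup `H`. -/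
noncomputable def supportRestrict (H : Subgroup G) : MonoidAlgebra ℤ G →ₗ[ℤ] MonoidAlgebra ℤ G :=
  Finsupp.linearCombination ℤ (fun g => if g ∈ H then of ℤ G g else 0) ∘ₗ
    (coeffLinearEquiv ℤ).toLinearMap

open Classical in
lemma supportRestrict_of (H : Subgroup G) (g : G) :
    supportRestrict H (of ℤ G g) = if g ∈ H then of ℤ G g else 0 := by
  simp [supportRestrict]

lemma linearMap_ext_of {M : Type*} [AddCommGroup M] {f g : MonoidAlgebra ℤ G →ₗ[ℤ] M}
    (h : ∀ x, f (of ℤ G x) = g (of ℤ G x)) : f = g :=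
  lhom_ext' fun x => LinearMap.ext_ring (h x)

lemma supportRestrict_mul_of (H : Subgroup G) {t : G} (ht : t ∈ H) (a : MonoidAlgebra ℤ G) :
    supportRestrict H (a * of ℤ G t) = supportRestrict H a * of ℤ G t := by
  classical
  have : supportRestrict H ∘ₗ LinearMap.mulRight ℤ (of ℤ G t) =
      LinearMap.mulRight ℤ (of ℤ G t) ∘ₗ supportRestrict H := by
    refine linearMap_ext_of fun g => ?_
    simp only [LinearMap.comp_apply, LinearMap.mulRight_apply, ← map_mul, supportRestrict_of,
      ite_mul, zero_mul]
    exact if_congr (Subgroup.mul_mem_cancel_right H ht) rfl rfl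
  exact LinearMap.congr_fun this a

variable [Finite G]

lemma supportRestrict_mul_sElt {H T : Subgroup G} (hT : T ≤ H) (a : MonoidAlgebra ℤ G) :
    supportRestrict H (a * sElt T) = supportRestrict H a * sElt T := by
  simp only [sElt, Finset.mul_sum, map_sum]
  exact Finset.sum_congr rfl fun t _ => supportRestrict_mul_of H (hT t.2) a

lemma supportRestrict_mem_span {ι : Type*} {H : Subgroup G} {T : ι → Subgroup G} {F : Set ι}
    (hT : ∀ i ∈ F, T i ≤ H) {x : MonoidAlgebra ℤ G}
    (hx : x ∈ Ideal.span ((fun i => sElt (T i)) '' F)) :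
    supportRestrict H x ∈ Ideal.span ((fun i => sElt (T i)) '' F) := by
  suffices ∀ a, supportRestrict H (a * x) ∈ Ideal.span ((fun i => sElt (T i)) '' F) by
    simpa using this 1
  induction hx using Submodule.span_induction with
  | mem x h =>
    obtain ⟨i, hi, rfl⟩ := h
    intro a
    simp only [supportRestrict_mul_sElt (hT i hi)]
    exact Ideal.mul_mem_left _ _ (Ideal.subset_span ⟨i, hi, rfl⟩)
  | zero => simp
  | add x y _ _ hx hy =>
    intro a
    rw [mul_add, map_add]
    exact add_mem (hx a) (hy a)
  | smul r x _ hx =>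
    intro a
    rw [smul_eq_mul, ← mul_assoc]
    exact hx _

lemma supportRestrict_sElt {S H : Subgroup G} (h : Disjoint S H) :
    supportRestrict H (sElt S) = 1 := by
  classical
  simp only [sElt, map_sum, supportRestrict_of]
  rw [Finset.sum_eq_single (1 : S)]
  · simp [one_def]
  · intro t _ ht
    rw [if_neg]
    exact fun htH => ht (Subtype.ext (Subgroup.disjoint_def.1 h t.2 htH))
  · simp

lemma sElt_mul_supportRestrict {S H : Subgroup G} (h : IsCompl S H) (a : MonoidAlgebra ℤ G) :
    sElt S * supportRestrict H (sElt S * a) = sElt S * a := by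
  have : LinearMap.mulLeft ℤ (sElt S) ∘ₗ supportRestrict H ∘ₗ LinearMap.mulLeft ℤ (sElt S) =
      LinearMap.mulLeft ℤ (sElt S) := by
    refine linearMap_ext_of fun g => ?_
    obtain ⟨t, ht, k, hk, rfl⟩ := Subgroup.mem_sup.1 (h.sup_eq_top ▸ Subgroup.mem_top g)
    have key : sElt S * of ℤ G (t * k) = sElt S * of ℤ G k := by
      rw [map_mul, ← mul_assoc, mul_comm (sElt S), of_mul_sElt S ht]
    simp only [LinearMap.comp_apply, LinearMap.mulLeft_apply, key]
    rw [supportRestrict_mul_of H hk, supportRestrict_sElt h.disjoint, one_mul]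
  exact LinearMap.congr_fun this a

end Restriction

lemma Ideal.mem_of_coprime_nsmul {R : Type*} [CommRing R] (J : Ideal R) {m n : ℕ}
    (h : m.Coprime n) {a : R} (hm : m • a ∈ J) (hn : n • a ∈ J) : a ∈ J := by
  obtain ⟨u, v, huv⟩ := Nat.isCoprime_iff_coprime.2 h
  have : a = u • (m • a) + v • (n • a) := by
    rw [← natCast_zsmul a m, ← natCast_zsmul a n, smul_smul, smul_smul, ← add_smul, huv, one_smul]
  rw [this]
  exact add_mem (zsmul_mem hm u) (zsmul_mem hn v)

/-- If `T` splits as `S × (T ⊓ H)` with `H` a complement of `S` containing all `T i`, and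
`T ⊓ H` has order prime to `ℓ`, then adjoining `s(T)` to the ideal generated by the `s(T i)`
creates no `ℓ`-torsion in the quotient. -/
lemma mem_span_insert_of_nsmul_mem {G : Type} [CommGroup G] [Finite G] {ℓ : ℕ} {ι : Type*}
    {T : ι → Subgroup G} {F : Set ι} {k : ι} {S H : Subgroup G}
    (hSH : IsCompl S H) (hST : S ≤ T k) (hTH : ∀ i ∈ F, T i ≤ H)
    (hcop : ℓ.Coprime (Nat.card (T k ⊓ H : Subgroup G)))
    (ih : ∀ a, ℓ • a ∈ Ideal.span ((fun i => sElt (T i)) '' F) →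
      a ∈ Ideal.span ((fun i => sElt (T i)) '' F))
    {a : MonoidAlgebra ℤ G}
    (ha : ℓ • a ∈ Ideal.span ((fun i => sElt (T i)) '' insert k F)) :
    a ∈ Ideal.span ((fun i => sElt (T i)) '' insert k F) := by
  have hsup : S ⊔ (T k ⊓ H) = T k := by
    rw [inf_comm, ← sup_inf_assoc_of_le H hST, hSH.sup_eq_top, top_inf_eq]
  have hN : sElt (T k) = sElt S * sElt (T k ⊓ H) := by
    rw [← sElt_sup_of_disjoint (hSH.disjoint.mono_right inf_le_right), hsup]
  have hWN : sElt (T k ⊓ H) * sElt (T k) = Nat.card (T k ⊓ H : Subgroup G) • sElt (T k) := by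
    rw [hN, mul_left_comm, sElt_mul_self, mul_smul_comm]
  set w := Nat.card (T k ⊓ H : Subgroup G)
  set W := sElt (T k ⊓ H)
  set N := sElt (T k)
  set I := Ideal.span ((fun i => sElt (T i)) '' F) with hI
  refine Ideal.mem_of_coprime_nsmul _ hcop ha ?_
  rw [Set.image_insert_eq] at ha ⊢
  obtain ⟨b, i₀, hi₀, hb⟩ := Ideal.mem_span_insert.1 ha
  have hE : supportRestrict H (sElt S * (W * b)) =
      ℓ • supportRestrict H a - supportRestrict H i₀ := by
    rw [← map_nsmul, ← map_sub, hb, ← mul_assoc, ← hN, mul_comm b, add_sub_cancel_right]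
  have hNb : N * b = sElt S * (ℓ • supportRestrict H a - supportRestrict H i₀) := by
    rw [← hE, sElt_mul_supportRestrict hSH, hN, mul_assoc]
  have hwNb : w • (N * b) = ℓ • (N * supportRestrict H a) - N * supportRestrict H i₀ := by
    rw [← smul_mul_assoc, ← hWN, mul_assoc, hNb, hN]
    simp only [nsmul_eq_mul]
    ring
  have hmem : w • a - N * supportRestrict H a ∈ I := by
    refine ih _ ?_
    have : ℓ • (w • a - N * supportRestrict H a) = w • i₀ - N * supportRestrict H i₀ := by
      rw [smul_sub, smul_comm, hb, smul_add, mul_comm b, hwNb]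
      abel
    rw [this]
    exact sub_mem (nsmul_mem hi₀ w) (Ideal.mul_mem_left _ _ (supportRestrict_mem_span hTH hi₀))
  exact Ideal.mem_span_insert.2 ⟨supportRestrict H a, _, hmem, by rw [mul_comm]; abel⟩

/-- A direct factor of the `ℓ`-primary component has a complement in the whole group, consisting
of the elements whose prime-to-`ℓ` power lies in a complementary factor `U`. -/
lemma exists_isCompl_of_primaryComponent {G : Type} [CommGroup G] [Finite G] {ℓ : ℕ}
    [hℓ : Fact ℓ.Prime] {S U : Subgroup G} (hd : Disjoint S U)
    (hsup : S ⊔ U = CommGroup.primaryComponent G ℓ) :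
    ∃ H : Subgroup G, IsCompl S H ∧
      ∀ T : Subgroup G, T ⊓ CommGroup.primaryComponent G ℓ ≤ U → T ≤ H := by
  obtain ⟨n, m, hm, hcard⟩ := Nat.exists_eq_pow_mul_and_not_dvd
    (Nat.card_pos (α := G)).ne' ℓ hℓ.out.ne_one
  have hcop : (ℓ ^ n).Coprime m := ((Nat.Prime.coprime_iff_not_dvd hℓ.out).2 hm).pow_left n
  have hpow : ∀ g ∈ S, g ^ ℓ ^ n = 1 := by
    intro g hg
    obtain ⟨j, hj⟩ := CommGroup.mem_primaryComponent_iff_orderOf.1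
      (hsup ▸ Subgroup.mem_sup_left hg)
    have hcop' : (orderOf g).Coprime m := by
      rw [hj]
      exact ((Nat.Prime.coprime_iff_not_dvd hℓ.out).2 hm).pow_left j
    exact orderOf_dvd_iff_pow_eq_one.1
      (hcop'.dvd_of_dvd_mul_right (hcard ▸ orderOf_dvd_natCard g))
  refine ⟨U.comap (powMonoidHom m), ⟨?_, ?_⟩, fun T hT t ht => hT ⟨pow_mem ht m, ?_⟩⟩
  · refine Subgroup.disjoint_def.2 fun {g} hg hgU => ?_
    have h1 : g ^ m = 1 := Subgroup.disjoint_def.1 hd (pow_mem hg m) hgU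
    exact orderOf_eq_one_iff.1 (Nat.eq_one_of_dvd_coprimes hcop
      (orderOf_dvd_of_pow_eq_one (hpow g hg)) (orderOf_dvd_of_pow_eq_one h1))
  · refine codisjoint_iff_le_sup.2 fun g _ => ?_
    have hgP : g ^ m ∈ S ⊔ U := by
      rw [hsup]
      exact ⟨n, by rw [← pow_mul, mul_comm, ← hcard, pow_card_eq_one']⟩
    obtain ⟨x, hx, u, hu, hxu⟩ := Subgroup.mem_sup.1 hgP
    obtain ⟨c, d, hcd⟩ := Nat.isCoprime_iff_coprime.2 hcop
    have hxd : (x ^ d) ^ m = x := by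
      have : x ^ (c * (ℓ ^ n : ℕ) + d * m) = x := by rw [hcd, zpow_one]
      rwa [zpow_add, mul_comm c, zpow_mul, zpow_natCast, hpow x hx, one_zpow, one_mul, zpow_mul,
        zpow_natCast] at this
    refine Subgroup.mem_sup.2 ⟨x ^ d, zpow_mem hx d, (x ^ d)⁻¹ * g, ?_, by group⟩
    change ((x ^ d)⁻¹ * g) ^ m ∈ U
    rwa [mul_pow, inv_pow, hxd, ← hxu, inv_mul_cancel_left]
  · exact ⟨n, by
      change (t ^ m) ^ ℓ ^ n = 1
      rw [← pow_mul, mul_comm, ← hcard, pow_card_eq_one']⟩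

/-- Let `ℓ` be a prime, `Γ` a finite abelian group and `T_1, …, T_s ≤ Γ` subgroups, with
`ℓ`-Sylow subgroups `S_i = T_i ⊓ (ℓ-primary component of Γ)`.  If the `ℓ`-Sylow subgroup
of `Γ` is the internal direct product of `S_1, …, S_s`, then `ℤ[Γ]/(s(T_1), …, s(T_s))`
has no `ℓ`-torsion. -/
theorem stmt_8 {Γ : Type} [CommGroup Γ] [Fintype Γ]
    (ℓ : ℕ) [hℓ : Fact ℓ.Prime] (s : ℕ) (T : Fin s → Subgroup Γ)
    (S : Fin s → Subgroup Γ)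
    (hS : ∀ i, S i = T i ⊓ CommGroup.primaryComponent Γ ℓ)
    (hindep : iSupIndep S)
    (hgen : (⨆ i, S i) = CommGroup.primaryComponent Γ ℓ) :
    ∀ x : MonoidAlgebra ℤ Γ ⧸ Ideal.span (Set.range fun i => sElt (T i)),
      ℓ • x = 0 → x = 0 := by
  have hST (i) : S i ≤ T i := hS i ▸ inf_le_left
  have key (F : Finset (Fin s)) : ∀ a : MonoidAlgebra ℤ Γ,
      ℓ • a ∈ Ideal.span ((fun i => sElt (T i)) '' (F : Set (Fin s))) →
        a ∈ Ideal.span ((fun i => sElt (T i)) '' (F : Set (Fin s))) := by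
    induction F using Finset.induction_on with
    | empty =>
      intro a ha
      rw [Finset.coe_empty, Set.image_empty, Ideal.span_empty, Ideal.mem_bot] at ha ⊢
      ext g
      have hg : (ℓ • a).coeff g = 0 := by rw [ha]; rfl
      rw [coeff_smul, Finsupp.smul_apply, smul_eq_zero] at hg
      exact hg.resolve_left hℓ.out.ne_zero
    | insert k F hk ih =>
      intro a ha
      rw [Finset.coe_insert] at ha ⊢
      obtain ⟨H, hH, hle⟩ := exists_isCompl_of_primaryComponent (hindep k)
        (by rw [← hgen, ← iSup_split_single S k])
      refine mem_span_insert_of_nsmul_mem hH (hST k) (fun i hi => hle _ ?_) ?_ ih ha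
      · rw [← hS i]
        exact le_iSup₂_of_le i (ne_of_mem_of_not_mem hi hk) le_rfl
      · rw [Nat.Prime.coprime_iff_not_dvd hℓ.out]
        intro hdvd
        obtain ⟨x, hx⟩ := exists_prime_orderOf_dvd_card' ℓ hdvd
        rw [← Subgroup.orderOf_coe] at hx
        have hxS : (x : Γ) ∈ S k := by
          rw [hS k]
          exact ⟨x.2.1, CommGroup.mem_primaryComponent_iff_orderOf.2 ⟨1, by rw [hx, pow_one]⟩⟩
        have := Subgroup.disjoint_def.1 hH.disjoint hxS x.2.2
        rw [this, orderOf_one] at hx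
        exact hℓ.out.ne_one hx.symm
  intro x hx
  obtain ⟨a, rfl⟩ := Ideal.Quotient.mk_surjective x
  rw [← map_nsmul, Ideal.Quotient.eq_zero_iff_mem] at hx
  rw [Ideal.Quotient.eq_zero_iff_mem]
  have := key Finset.univ a
  simp only [Finset.coe_univ, Set.image_univ] at this
  exact this hx
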